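/- For any λ ≥ 1, c ≥ 0, and k ≥ 0 there exists a constant ε = ε(λ, c, k) > 0 with the following property: if p and q are two k-similar (λ, c)-quasi-geodesic paths in Γ(G, X ∪ 𝓗) such that p is a path without backtracking, then for any phase vertex u of p there exists a phase vertex v of q such that dist_X(u, v) ≤ ε. -/

import Mathlib

namespace RelHyp

variable {G : Type*} [Group G] {Λ : Type*}

/-- Length of a shortest word over the alphabet `S ∪ S⁻¹` representing `g`. -/
noncomputable def wordLength (S : Set G) (g : G) : ℕ :=
  sInf {n | ∃ w : List G, w.length = n ∧ (∀ x ∈ w, x ∈ S ∨ x⁻¹ ∈ S) ∧ w.prod = g}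

/-- The free product `F = (∗_λ H_λ) ∗ F(X)`. -/
abbrev RelFree (H : Λ → Subgroup G) (X : Set G) : Type _ :=
  Monoid.Coprod (Monoid.CoprodI fun l => ↥(H l)) (FreeGroup ↥X)

/-- The canonical homomorphism `ε : F → G`. -/
def relEps (H : Λ → Subgroup G) (X : Set G) : RelFree H X →* G :=
  Monoid.Coprod.lift (Monoid.CoprodI.lift fun l => (H l).subtype)
    (FreeGroup.lift fun x => (x : G))

/-- Letters of the alphabet `X ∪ 𝓗`, where `𝓗 = ⊔_λ (H̃_λ ∖ {1})`. -/
abbrev RelLetter (H : Λ → Subgroup G) (X : Set G) : Type _ :=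
  (Σ l : Λ, {h : ↥(H l) // h ≠ 1}) ⊕ (↥X × Bool)

/-- The image of a letter in the free product `F`. -/
def RelLetter.toF {H : Λ → Subgroup G} {X : Set G} : RelLetter H X → RelFree H X
  | Sum.inl ⟨_, h⟩ => Monoid.Coprod.inl (Monoid.CoprodI.of h.1)
  | Sum.inr (x, b) => Monoid.Coprod.inr (if b then FreeGroup.of x else (FreeGroup.of x)⁻¹)

/-- The element of `G` represented by a letter. -/
def RelLetter.val {H : Λ → Subgroup G} {X : Set G} : RelLetter H X → G
  | Sum.inl ⟨_, h⟩ => (h.1 : G)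
  | Sum.inr (x, b) => if b then (x : G) else (x : G)⁻¹

/-- The index `λ` such that the letter belongs to `H̃_λ`, if any. -/
def RelLetter.hIndex {H : Λ → Subgroup G} {X : Set G} : RelLetter H X → Option Λ
  | Sum.inl ⟨l, _⟩ => some l
  | Sum.inr _ => none

/-- The element of `F` represented by a word over `X ∪ 𝓗`. -/
def wordToF {H : Λ → Subgroup G} {X : Set G} (w : List (RelLetter H X)) : RelFree H X :=
  (w.map RelLetter.toF).prod

/-- `f` is a relative isoperimetric function of the relative presentation `⟨X, H | R⟩`. -/
def IsIsoperFn (H : Λ → Subgroup G) (X : Set G) (R : Set (RelFree H X)) (f : ℕ → ℕ) : Prop :=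
  ∀ w : List (RelLetter H X), relEps H X (wordToF w) = 1 →
    ∃ k ≤ f w.length, ∃ r c : Fin k → RelFree H X,
      (∀ i, r i ∈ R) ∧ wordToF w = (List.ofFn fun i => (c i)⁻¹ * r i * c i).prod

/-- `⟨X, H | R⟩` is a finite relative presentation of `G` w.r.t. the collection `H`. -/
structure IsFiniteRelPres (H : Λ → Subgroup G) (X : Set G) (R : Set (RelFree H X)) : Prop where
  finX : X.Finite
  finR : R.Finite
  surj : Function.Surjective (relEps H X)
  ker : (relEps H X).ker = Subgroup.normalClosure R

/-- `G` is finitely presented relative to the collection of subgroups `H`. -/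
def FinitelyPresentedRel (H : Λ → Subgroup G) : Prop :=
  ∃ (X : Set G) (R : Set (RelFree H X)), IsFiniteRelPres H X R

/-- The relative area of a word representing `1`. -/
noncomputable def relArea (H : Λ → Subgroup G) (X : Set G) (R : Set (RelFree H X))
    (w : List (RelLetter H X)) : ℕ :=
  sInf {k | ∃ r c : Fin k → RelFree H X,
    (∀ i, r i ∈ R) ∧ wordToF w = (List.ofFn fun i => (c i)⁻¹ * r i * c i).prod}

/-- The relative Dehn function of the presentation `⟨X, H | R⟩`. -/
noncomputable def relDehn (H : Λ → Subgroup G) (X : Set G) (R : Set (RelFree H X))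
    (n : ℕ) : ℕ :=
  sSup {a | ∃ w : List (RelLetter H X), w.length ≤ n ∧ relEps H X (wordToF w) = 1 ∧
    a = relArea H X R w}

/-- The relative Dehn function is well-defined (finite for each value of the argument),
i.e. there exists a finite-valued relative isoperimetric function. -/
def DehnWellDefined (H : Λ → Subgroup G) (X : Set G) (R : Set (RelFree H X)) : Prop :=
  ∃ f : ℕ → ℕ, IsIsoperFn H X R f

/-- `f ⪯ g`. -/
def AsympLE (f g : ℕ → ℕ) : Prop := ∃ C K L : ℕ, ∀ n, f n ≤ C * g (K * n) + L * n

/-- `f ∼ g`. -/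
def AsympEquiv (f g : ℕ → ℕ) : Prop := AsympLE f g ∧ AsympLE g f

/-- `G` is hyperbolic relative to `H`: it admits a finite relative presentation with a
linear relative isoperimetric function. -/
def IsRelHyperbolic (H : Λ → Subgroup G) : Prop :=
  ∃ (X : Set G) (R : Set (RelFree H X)), IsFiniteRelPres H X R ∧
    ∃ A B : ℕ, IsIsoperFn H X R fun n => A * n + B

/-- The subnegative closure of `f`. -/
noncomputable def subnegClosure (f : ℕ → ℕ) (n : ℕ) : ℕ :=
  sSup {s | ∃ L : List ℕ, (∀ a ∈ L, 0 < a) ∧ L.sum = n ∧ s = (L.map f).sum}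

/-- A combinatorial path in the Cayley graph `Γ(G, X ∪ 𝓗)`: a starting vertex
together with the word labelling the path. -/
structure RelPath (H : Λ → Subgroup G) (X : Set G) where
  start : G
  word : List (RelLetter H X)

namespace RelPath

variable {H : Λ → Subgroup G} {X : Set G}

/-- The length of the path. -/
def len (p : RelPath H X) : ℕ := p.word.length

/-- The `k`-th vertex of the path. -/
def vertex (p : RelPath H X) (k : ℕ) : G :=
  p.start * ((p.word.take k).map RelLetter.val).prod

/-- The terminal vertex of the path. -/
def finish (p : RelPath H X) : G := p.vertex p.word.length

end RelPath

/-- The combinatorial metric `dist_{X ∪ 𝓗}` on `G`. -/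
noncomputable def relDist (H : Λ → Subgroup G) (X : Set G) (g h : G) : ℕ :=
  wordLength (X ∪ ⋃ l, (H l : Set G)) (g⁻¹ * h)

/-- The relative length `|g|_{X ∪ 𝓗}`. -/
noncomputable def relLen (H : Λ → Subgroup G) (X : Set G) (g : G) : ℕ :=
  wordLength (X ∪ ⋃ l, (H l : Set G)) g

/-- The word metric `dist_X` on `G`. -/
noncomputable def xDist (X : Set G) (g h : G) : ℕ := wordLength X (g⁻¹ * h)

variable {H : Λ → Subgroup G} {X : Set G}

/-- `p` is a `(λ, c)`-quasi-geodesic in `Γ(G, X ∪ 𝓗)`. -/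
def IsQuasiGeodesic (lam c : ℝ) (p : RelPath H X) : Prop :=
  ∀ i j : ℕ, i ≤ j → j ≤ p.len →
    ((j - i : ℕ) : ℝ) ≤ lam * (relDist H X (p.vertex i) (p.vertex j) : ℝ) + c

/-- `p` is a geodesic in `Γ(G, X ∪ 𝓗)`. -/
def IsGeodesic (p : RelPath H X) : Prop :=
  ∀ i j : ℕ, i ≤ j → j ≤ p.len → j - i = relDist H X (p.vertex i) (p.vertex j)

/-- The `k`-th letter of `p` is a letter of `H̃_l`. -/
def LetterIsH (p : RelPath H X) (l : Λ) (k : ℕ) : Prop :=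
  ∃ a, p.word[k]? = some a ∧ a.hIndex = some l

/-- The subpath of `p` consisting of the letters with indices `a, …, b` is an
`H_l`-component of `p` (a maximal nonempty `H_l`-subword). -/
def IsComponent (p : RelPath H X) (l : Λ) (a b : ℕ) : Prop :=
  a ≤ b ∧ b < p.len ∧ (∀ k, a ≤ k → k ≤ b → LetterIsH p l k) ∧
    (a = 0 ∨ ¬ LetterIsH p l (a - 1)) ∧ (b + 1 = p.len ∨ ¬ LetterIsH p l (b + 1))

/-- The `H_l`-components of `p` starting at index `a` and of `q` starting at `a'`
are connected (their vertices lie in the same left coset of `H_l`). -/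
def ConnectedComp (p q : RelPath H X) (l : Λ) (a a' : ℕ) : Prop :=
  (p.vertex a)⁻¹ * q.vertex a' ∈ H l

/-- `p` is a path without backtracking: all of its components are isolated. -/
def NoBacktracking (p : RelPath H X) : Prop :=
  ∀ l a b a' b', IsComponent p l a b → IsComponent p l a' b' →
    ConnectedComp p p l a a' → a = a' ∧ b = b'

/-- The `k`-th vertex of `p` is a phase vertex (not an inner vertex of a component). -/
def IsPhase (p : RelPath H X) (k : ℕ) : Prop :=
  ¬ ∃ l a b, IsComponent p l a b ∧ a < k ∧ k ≤ b

/-- `p` and `q` are `k`-similar: their endpoints are `X`-distance at most `k` apart. -/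
def Similar (k : ℝ) (p q : RelPath H X) : Prop :=
  (xDist X p.start q.start : ℝ) ≤ k ∧ (xDist X p.finish q.finish : ℝ) ≤ k

/-- The Rips thin-triangles condition for `Γ(G, X ∪ 𝓗)` with constant `δ`. -/
def RipsThin (H : Λ → Subgroup G) (X : Set G) (δ : ℝ) : Prop :=
  ∀ p q r : RelPath H X, IsGeodesic p → IsGeodesic q → IsGeodesic r →
    p.finish = q.start → q.finish = r.start → r.finish = p.start →
    ∀ i ≤ p.len, ∃ j : ℕ,
      (j ≤ q.len ∧ (relDist H X (p.vertex i) (q.vertex j) : ℝ) ≤ δ) ∨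
      (j ≤ r.len ∧ (relDist H X (p.vertex i) (r.vertex j) : ℝ) ≤ δ)

/-- The Cayley graph `Γ(G, X ∪ 𝓗)` is a hyperbolic metric space. -/
def CayleyHyperbolic (H : Λ → Subgroup G) (X : Set G) : Prop :=
  ∃ δ : ℝ, 0 ≤ δ ∧ RipsThin H X δ

/-- `R` is a relatively quasi-convex subgroup of `G`. -/
def RelQuasiconvex (H : Λ → Subgroup G) (X : Set G) (R : Subgroup G) : Prop :=
  ∃ σ : ℝ, 0 < σ ∧ ∀ p : RelPath H X, IsGeodesic p → p.start ∈ R → p.finish ∈ R →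
    ∀ k ≤ p.len, ∃ w ∈ R, (xDist X (p.vertex k) w : ℝ) ≤ σ

/-- `R` is a strongly relatively quasi-convex subgroup of `G`. -/
def StronglyRelQuasiconvex (H : Λ → Subgroup G) (X : Set G) (R : Subgroup G) : Prop :=
  RelQuasiconvex H X R ∧ ∀ (g : G) (l : Λ), {x : G | x ∈ R ∧ g * x * g⁻¹ ∈ H l}.Finite

/-- `g` is a hyperbolic element: it is not conjugate to an element of any `H_λ`. -/
def IsHypElt (H : Λ → Subgroup G) (g : G) : Prop :=
  ∀ l : Λ, ∀ x ∈ H l, ¬ IsConj g x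

end RelHyp

open RelHyp

namespace RelHyp

section WordLength

variable {G : Type*} [Group G] {S : Set G}

theorem wordLength_le_length {w : List G} (hw : ∀ x ∈ w, x ∈ S ∨ x⁻¹ ∈ S) :
    wordLength S w.prod ≤ w.length :=
  Nat.sInf_le ⟨w, rfl, hw, rfl⟩

theorem exists_word_length_eq (hS : Subgroup.closure S = ⊤) (g : G) :
    ∃ w : List G, w.length = wordLength S g ∧ (∀ x ∈ w, x ∈ S ∨ x⁻¹ ∈ S) ∧ w.prod = g := by
  have hg : g ∈ Subgroup.closure S := hS ▸ Subgroup.mem_top g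
  rw [← Subgroup.mem_toSubmonoid, Subgroup.closure_toSubmonoid] at hg
  obtain ⟨w, hw, hprod⟩ := Submonoid.exists_list_of_mem_closure hg
  exact Nat.sInf_mem (s := {n | ∃ w : List G, w.length = n ∧
    (∀ x ∈ w, x ∈ S ∨ x⁻¹ ∈ S) ∧ w.prod = g}) ⟨_, w, rfl, hw, hprod⟩

@[simp]
theorem wordLength_one : wordLength S (1 : G) = 0 :=
  Nat.le_zero.1 (wordLength_le_length (S := S) (w := []) (by simp))

theorem wordLength_le_one {s : G} (hs : s ∈ S ∨ s⁻¹ ∈ S) : wordLength S s ≤ 1 := by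
  simpa using wordLength_le_length (S := S) (w := [s]) (by simpa using hs)

theorem wordLength_mul_le (hS : Subgroup.closure S = ⊤) (g h : G) :
    wordLength S (g * h) ≤ wordLength S g + wordLength S h := by
  obtain ⟨v, hv, hvS, rfl⟩ := exists_word_length_eq hS g
  obtain ⟨w, hw, hwS, rfl⟩ := exists_word_length_eq hS h
  rw [← hv, ← hw, ← List.prod_append, ← List.length_append]
  refine wordLength_le_length fun x hx => ?_
  rcases List.mem_append.1 hx with hx | hx
  exacts [hvS x hx, hwS x hx]

theorem wordLength_inv_le (hS : Subgroup.closure S = ⊤) (g : G) :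
    wordLength S g⁻¹ ≤ wordLength S g := by
  obtain ⟨v, hv, hvS, rfl⟩ := exists_word_length_eq hS g
  rw [← hv, List.prod_inv_reverse]
  refine (wordLength_le_length fun x hx => ?_).trans (by simp)
  simp only [List.mem_reverse, List.mem_map] at hx
  obtain ⟨y, hy, rfl⟩ := hx
  simpa using (hvS y hy).symm

theorem wordLength_inv (hS : Subgroup.closure S = ⊤) (g : G) :
    wordLength S g⁻¹ = wordLength S g :=
  (wordLength_inv_le hS g).antisymm (by simpa using wordLength_inv_le hS g⁻¹)

theorem wordLength_mono {T : Set G} (hST : S ⊆ T) (hS : Subgroup.closure S = ⊤) (g : G) :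
    wordLength T g ≤ wordLength S g := by
  obtain ⟨v, hv, hvS, rfl⟩ := exists_word_length_eq hS g
  rw [← hv]
  exact wordLength_le_length fun x hx => (hvS x hx).imp (fun h => hST h) fun h => hST h

end WordLength

section Metrics

variable {G : Type*} [Group G] {Λ : Type*} {H : Λ → Subgroup G} {X : Set G}

theorem closure_union_eq_top (hX : Subgroup.closure X = ⊤) :
    Subgroup.closure (X ∪ ⋃ l, (H l : Set G)) = ⊤ :=
  top_le_iff.1 (hX ▸ Subgroup.closure_mono Set.subset_union_left)

@[simp]
theorem xDist_self (g : G) : xDist X g g = 0 := by simp [xDist]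

theorem xDist_comm (hX : Subgroup.closure X = ⊤) (g h : G) : xDist X g h = xDist X h g := by
  rw [xDist, xDist, ← wordLength_inv hX, mul_inv_rev, inv_inv]

theorem xDist_triangle (hX : Subgroup.closure X = ⊤) (g h k : G) :
    xDist X g k ≤ xDist X g h + xDist X h k := by
  rw [xDist, show g⁻¹ * k = g⁻¹ * h * (h⁻¹ * k) by group]
  exact wordLength_mul_le hX _ _

@[simp]
theorem relDist_self (g : G) : relDist H X g g = 0 := by simp [relDist]

theorem relDist_comm (hX : Subgroup.closure X = ⊤) (g h : G) :
    relDist H X g h = relDist H X h g := by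
  rw [relDist, relDist, ← wordLength_inv (closure_union_eq_top hX), mul_inv_rev, inv_inv]

theorem relDist_triangle (hX : Subgroup.closure X = ⊤) (g h k : G) :
    relDist H X g k ≤ relDist H X g h + relDist H X h k := by
  rw [relDist, show g⁻¹ * k = g⁻¹ * h * (h⁻¹ * k) by group]
  exact wordLength_mul_le (closure_union_eq_top hX) _ _

theorem relDist_le_xDist (hX : Subgroup.closure X = ⊤) (g h : G) :
    relDist H X g h ≤ xDist X g h :=
  wordLength_mono Set.subset_union_left hX _

theorem relDist_le_one_of_mem {l : Λ} {g h : G} (hl : g⁻¹ * h ∈ H l) : relDist H X g h ≤ 1 :=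
  wordLength_le_one (Or.inl (Or.inr (Set.mem_iUnion.2 ⟨l, hl⟩)))

theorem abs_sub_xDist_le (hX : Subgroup.closure X = ⊤) (x g h : G) :
    |(xDist X x h : ℝ) - xDist X x g| ≤ xDist X g h := by
  have h₁ := xDist_triangle hX x g h
  have h₂ := xDist_triangle hX x h g
  rw [xDist_comm hX h g] at h₂
  rw [abs_le]
  constructor <;> [have := (Nat.cast_le (α := ℝ)).2 h₂; have := (Nat.cast_le (α := ℝ)).2 h₁] <;>
    push_cast at this <;> linarith

theorem abs_sub_relDist_le (hX : Subgroup.closure X = ⊤) (x g h : G) :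
    |(relDist H X x h : ℝ) - relDist H X x g| ≤ relDist H X g h := by
  have h₁ := relDist_triangle (H := H) hX x g h
  have h₂ := relDist_triangle (H := H) hX x h g
  rw [relDist_comm hX h g] at h₂
  rw [abs_le]
  constructor <;> [have := (Nat.cast_le (α := ℝ)).2 h₂; have := (Nat.cast_le (α := ℝ)).2 h₁] <;>
    push_cast at this <;> linarith

end Metrics

section Cocycles

variable {G : Type*} [Group G] {Λ : Type*} {H : Λ → Subgroup G}

/-- The action of `G` on real functions on `G` by right translation of the argument. -/
def translationAut (G : Type*) [Group G] : G →* MulAut (Multiplicative (G → ℝ)) where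
  toFun g :=
    { toFun := fun n => Multiplicative.ofAdd fun x => n.toAdd (x * g)
      invFun := fun n => Multiplicative.ofAdd fun x => n.toAdd (x * g⁻¹)
      left_inv := fun n => by ext; simp
      right_inv := fun n => by ext; simp
      map_mul' := fun m n => rfl }
  map_one' := by ext n; simp
  map_mul' g h := by ext n; simp [mul_assoc]

/-- `D` is a derivation of the free product `F` which is the coboundary of `β l` on `H l` and
is the one-form `a db` on the free generators. -/
structure IsDerivation {X : Set G} (a b : G → ℝ) (β : Λ → G → ℝ)
    (D : RelFree H X → G → ℝ) : Prop where
  mul : ∀ f f' g, D (f * f') g = D f g + D f' (g * relEps H X f)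
  of_subgroup : ∀ l (h : H l) g, D (Monoid.Coprod.inl (Monoid.CoprodI.of h)) g =
    β l (g * h) - β l g
  of_gen : ∀ (x : X) g, D (Monoid.Coprod.inr (FreeGroup.of x)) g = a g * (b (g * x) - b g)

theorem exists_isDerivation (X : Set G) (a b : G → ℝ) (β : Λ → G → ℝ) :
    ∃ D : RelFree H X → G → ℝ, IsDerivation a b β D := by
  let T := Multiplicative (G → ℝ) ⋊[translationAut G] G
  let Φ : RelFree H X →* T := Monoid.Coprod.lift
    (Monoid.CoprodI.lift fun l =>
      { toFun := fun h => ⟨Multiplicative.ofAdd fun g => β l (g * h) - β l g, h⟩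
        map_one' := by
          ext <;> simp
        map_mul' := fun h h' => by
          ext g
          · change β l (g * ((h : G) * h')) - β l g =
              β l (g * h) - β l g + (β l (g * h * h') - β l (g * h))
            rw [mul_assoc]
            ring
          · rfl })
    (FreeGroup.lift fun x => ⟨Multiplicative.ofAdd fun g => a g * (b (g * x) - b g), x⟩)
  have hΦ : ∀ f, (Φ f).right = relEps H X f := by
    intro f
    refine DFunLike.congr_fun (f := SemidirectProduct.rightHom.comp Φ) ?_ f
    apply Monoid.Coprod.hom_ext
    · apply Monoid.CoprodI.ext_hom
      intro l
      ext h
      simp [Φ, relEps]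
    · ext x
      simp [Φ, relEps]
  refine ⟨fun f => (Φ f).left.toAdd, fun f f' g => ?_, fun l h g => ?_, fun x g => ?_⟩
  · rw [map_mul, ← hΦ]
    rfl
  · simp [Φ]
  · simp [Φ]

namespace IsDerivation

variable {X : Set G} {a b : G → ℝ} {β : Λ → G → ℝ} {D : RelFree H X → G → ℝ}

theorem one (hD : IsDerivation a b β D) (g : G) : D 1 g = 0 := by
  have := hD.mul 1 1 g
  simp only [mul_one, map_one] at this
  linarith

theorem inv (hD : IsDerivation a b β D) (f : RelFree H X) (g : G) :
    D f⁻¹ g = -D f (g * (relEps H X f)⁻¹) := by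
  have := hD.mul f⁻¹ f g
  rw [inv_mul_cancel, hD.one, map_inv] at this
  linarith

theorem conj (hD : IsDerivation a b β D) {r : RelFree H X} (hr : relEps H X r = 1)
    (c : RelFree H X) (g : G) : D (c⁻¹ * r * c) g = D r (g * (relEps H X c)⁻¹) := by
  simp [hD.mul, hD.inv, hr]

theorem abs_prod_le (hD : IsDerivation a b β D) {N : ℝ} (L : List (RelFree H X))
    (hL : ∀ f ∈ L, relEps H X f = 1 ∧ ∀ g, |D f g| ≤ N) (g : G) :
    |D L.prod g| ≤ N * L.length := by
  induction L with
  | nil => simp [hD.one]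
  | cons f L ih =>
    have hf := hL f (by simp)
    have := ih fun f' hf' => hL f' (by simp [hf'])
    rw [List.prod_cons, hD.mul, hf.1, mul_one, List.length_cons]
    push_cast
    linarith [abs_add_le (D f g) (D L.prod g), hf.2 g]

end IsDerivation

/-- `a` and `b` are 1-Lipschitz for `dist_X`, and `β l` is a primitive of an approximation of
the one-form `a db` along the cosets of `H l`. -/
structure IsApproxPrimitive (H : Λ → Subgroup G) (X : Set G) (a b : G → ℝ)
    (β : Λ → G → ℝ) : Prop where
  lipschitz_left : ∀ g h, |a (g * h) - a g| ≤ wordLength X h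
  lipschitz_right : ∀ g h, |b (g * h) - b g| ≤ wordLength X h
  close : ∀ l g, ∀ h ∈ H l, |β l (g * h) - β l g - a g * (b (g * h) - b g)| ≤ 1 + wordLength X h

theorem exists_derivation_bound {X Y : Set G} (f : RelFree H Y) :
    ∃ N : ℝ, ∀ (a b : G → ℝ) (β : Λ → G → ℝ) (D : RelFree H Y → G → ℝ),
      IsApproxPrimitive H X a b β → IsDerivation a b β D →
      ∀ g, |D f g - a g * (b (g * relEps H Y f) - b g)| ≤ N := by
  have hmul : ∀ f f' : RelFree H Y,
    (∃ N : ℝ, ∀ (a b : G → ℝ) (β : Λ → G → ℝ) (D : RelFree H Y → G → ℝ),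
      IsApproxPrimitive H X a b β → IsDerivation a b β D →
      ∀ g, |D f g - a g * (b (g * relEps H Y f) - b g)| ≤ N) →
    (∃ N : ℝ, ∀ (a b : G → ℝ) (β : Λ → G → ℝ) (D : RelFree H Y → G → ℝ),
      IsApproxPrimitive H X a b β → IsDerivation a b β D →
      ∀ g, |D f' g - a g * (b (g * relEps H Y f') - b g)| ≤ N) →
    ∃ N : ℝ, ∀ (a b : G → ℝ) (β : Λ → G → ℝ) (D : RelFree H Y → G → ℝ),
      IsApproxPrimitive H X a b β → IsDerivation a b β D →
      ∀ g, |D (f * f') g - a g * (b (g * relEps H Y (f * f')) - b g)| ≤ N := by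
    rintro f f' ⟨N, hN⟩ ⟨N', hN'⟩
    refine ⟨N + N' + wordLength X (relEps H Y f) * wordLength X (relEps H Y f'),
      fun a b β D hab hD g => ?_⟩
    have h₁ := hN a b β D hab hD g
    have h₂ := hN' a b β D hab hD (g * relEps H Y f)
    have h₃ := mul_le_mul (hab.lipschitz_left g (relEps H Y f))
      (hab.lipschitz_right (g * relEps H Y f) (relEps H Y f')) (abs_nonneg _) (Nat.cast_nonneg _)
    rw [← abs_mul] at h₃
    rw [hD.mul, map_mul, ← mul_assoc]
    rw [abs_le] at *
    constructor <;> linarith [h₁.1, h₁.2, h₂.1, h₂.2, h₃.1, h₃.2]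
  have hone : ∃ N : ℝ, ∀ (a b : G → ℝ) (β : Λ → G → ℝ) (D : RelFree H Y → G → ℝ),
      IsApproxPrimitive H X a b β → IsDerivation a b β D →
      ∀ g, |D 1 g - a g * (b (g * relEps H Y 1) - b g)| ≤ N :=
    ⟨0, fun a b β D _ hD g => by simp [hD.one]⟩
  induction f using Monoid.Coprod.induction_on with
  | mul f f' hf hf' => exact hmul f f' hf hf'
  | inl f =>
    induction f using Monoid.CoprodI.induction_on with
    | one => simpa using hone
    | mul f f' hf hf' => rw [map_mul]; exact hmul _ _ hf hf'
    | of l h =>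
      refine ⟨1 + wordLength X (h : G), fun a b β D hab hD g => ?_⟩
      simpa [hD.of_subgroup, relEps] using hab.close l g h h.2
  | inr f =>
    induction f using FreeGroup.induction_on with
    | C1 => simpa using hone
    | mul f f' hf hf' => rw [map_mul]; exact hmul _ _ hf hf'
    | of x =>
      refine ⟨0, fun a b β D hab hD g => ?_⟩
      simp [hD.of_gen, relEps]
    | inv_of x _ =>
      refine ⟨wordLength X (x : G)⁻¹ * wordLength X (x : G)⁻¹, fun a b β D hab hD g => ?_⟩
      have h := mul_le_mul (hab.lipschitz_left g (x : G)⁻¹) (hab.lipschitz_right g (x : G)⁻¹)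
        (abs_nonneg _) (Nat.cast_nonneg _)
      rw [← abs_mul] at h
      change |D (Monoid.Coprod.inr (FreeGroup.of x)⁻¹) g - _| ≤ _
      have he : relEps H Y (Monoid.Coprod.inr (FreeGroup.of x)) = x := by simp [relEps]
      rw [map_inv, hD.inv, map_inv, he, hD.of_gen, inv_mul_cancel_right]
      refine le_of_eq_of_le (congrArg abs ?_) h
      ring

/-- Every element of the free product is represented by a word. -/
theorem wordToF_surjective (Y : Set G) :
    Function.Surjective (wordToF : List (RelLetter H Y) → RelFree H Y) := by
  have hmul : ∀ f f' : RelFree H Y, (∃ w, wordToF w = f) → (∃ w, wordToF w = f') →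
      ∃ w, wordToF w = f * f' := by
    rintro _ _ ⟨w, rfl⟩ ⟨w', rfl⟩
    exact ⟨w ++ w', by simp [wordToF]⟩
  have hone : ∃ w, wordToF w = (1 : RelFree H Y) := ⟨[], rfl⟩
  intro f
  induction f using Monoid.Coprod.induction_on with
  | mul f f' hf hf' => exact hmul f f' hf hf'
  | inl f =>
    induction f using Monoid.CoprodI.induction_on with
    | one => simpa using hone
    | mul f f' hf hf' => rw [map_mul]; exact hmul _ _ hf hf'
    | of l h =>
      rcases eq_or_ne h 1 with rfl | hh
      · simpa using hone
      · exact ⟨[Sum.inl ⟨l, h, hh⟩], by simp [wordToF, RelLetter.toF]⟩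
  | inr f =>
    induction f using FreeGroup.induction_on with
    | C1 => simpa using hone
    | mul f f' hf hf' => rw [map_mul]; exact hmul _ _ hf hf'
    | of x => exact ⟨[Sum.inr (x, true)], by simp [wordToF, RelLetter.toF]⟩
    | inv_of x _ => exact ⟨[Sum.inr (x, false)], by simp [wordToF, RelLetter.toF]⟩

end Cocycles

section Chains

variable {G : Type*}

/-- `Chain S n g h` holds if `h` can be reached from `g` in exactly `n` steps of `S`. -/
inductive Chain (S : G → G → Prop) : ℕ → G → G → Prop
  | nil (g : G) : Chain S 0 g g
  | snoc {n : ℕ} {g h k : G} : Chain S n g h → S h k → Chain S (n + 1) g k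

/-- A chain of `n` steps of `S` together with the sum of the weights of its steps. -/
inductive WeightedChain (S : G → G → ℝ → Prop) : ℕ → ℝ → G → G → Prop
  | nil (g : G) : WeightedChain S 0 0 g g
  | snoc {n : ℕ} {s t : ℝ} {g h k : G} :
      WeightedChain S n s g h → S h k t → WeightedChain S (n + 1) (s + t) g k

namespace Chain

variable {S T : G → G → Prop} {m n : ℕ} {g h k : G}

theorem trans (hgh : Chain S m g h) (hhk : Chain S n h k) : Chain S (m + n) g k := by
  induction hhk with
  | nil => exact hgh
  | snoc _ hs ih => exact (ih hgh).snoc hs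

theorem symm (hS : ∀ g h, S g h → S h g) (hgh : Chain S n g h) : Chain S n h g := by
  induction hgh with
  | nil => exact nil _
  | snoc _ hs ih =>
    rw [add_comm]
    exact ((nil _).snoc (hS _ _ hs)).trans ih

theorem mono (hST : ∀ g h, S g h → T g h) (hgh : Chain S n g h) : Chain T n g h := by
  induction hgh with
  | nil => exact nil _
  | snoc _ hs ih => exact ih.snoc (hST _ _ hs)

theorem of_fun (f : ℕ → G) {i j : ℕ} (hij : i ≤ j)
    (hf : ∀ m, i ≤ m → m < j → S (f m) (f (m + 1))) : Chain S (j - i) (f i) (f j) := by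
  induction j, hij using Nat.le_induction with
  | base => simpa using nil (f i)
  | succ j hij ih =>
    rw [Nat.sub_add_comm hij]
    exact (ih fun m hm hmj => hf m hm (by omega)).snoc (hf j hij (by omega))

theorem of_fun_of_symm (hS : ∀ g h, S g h → S h g) (f : ℕ → G) {i j : ℕ}
    (hf : ∀ m, min i j ≤ m → m < max i j → S (f m) (f (m + 1))) :
    Chain S ((j - i) + (i - j)) (f i) (f j) := by
  rcases le_total i j with hij | hij
  · rw [Nat.sub_eq_zero_of_le hij, add_zero]
    exact of_fun f hij fun m h₁ h₂ => hf m (by omega) (by omega)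
  · rw [Nat.sub_eq_zero_of_le hij, zero_add]
    exact (of_fun f hij fun m h₁ h₂ => hf m (by omega) (by omega)).symm hS

theorem exists_fun (hgh : Chain S n g h) :
    ∃ f : ℕ → G, f 0 = g ∧ f n = h ∧ ∀ m < n, S (f m) (f (m + 1)) := by
  induction hgh with
  | nil g => exact ⟨fun _ => g, rfl, rfl, by simp⟩
  | @snoc n g h k _ hs ih =>
    obtain ⟨f, h0, hn, hf⟩ := ih
    refine ⟨fun m => if m ≤ n then f m else k, by simpa using h0, by simp, fun m hm => ?_⟩
    rcases (Nat.lt_succ_iff.1 hm).lt_or_eq with hlt | rfl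
    · simpa [hlt.le, Nat.succ_le_of_lt hlt] using hf m hlt
    · simpa [hn] using hs

end Chain

theorem WeightedChain.trans {S : G → G → ℝ → Prop} {m n : ℕ} {s t : ℝ} {g h k : G}
    (hgh : WeightedChain S m s g h) (hhk : WeightedChain S n t h k) :
    WeightedChain S (m + n) (s + t) g k := by
  induction hhk with
  | nil => simpa using hgh
  | snoc _ hs ih =>
    rw [← add_assoc, ← add_assoc]
    exact (ih hgh).snoc hs

end Chains

section Filling

variable {G : Type*} [Group G] {Λ : Type*} {H : Λ → Subgroup G} {X : Set G}

/-- The weight of an edge of the Cayley graph: the coboundary of `β l` on edges labelled by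
`H l`, and `a db` on edges labelled by `X`. -/
def EdgeWeight (H : Λ → Subgroup G) (X : Set G) (a b : G → ℝ) (β : Λ → G → ℝ)
    (g h : G) (t : ℝ) : Prop :=
  ((g⁻¹ * h ∈ X ∨ (g⁻¹ * h)⁻¹ ∈ X) ∧ t = a g * (b h - b g)) ∨
    ∃ l, g⁻¹ * h ∈ H l ∧ t = β l h - β l g

theorem exists_forall_le_of_finite {α : Type*} {s : Set α} (hs : s.Finite) (f : α → ℝ) :
    ∃ M : ℝ, 0 ≤ M ∧ ∀ x ∈ s, f x ≤ M := by
  obtain ⟨M, hM⟩ := (hs.image f).bddAbove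
  exact ⟨max M 0, le_max_right _ _, fun x hx => (hM ⟨x, hx, rfl⟩).trans (le_max_left _ _)⟩

/-- The linear isoperimetric inequality in dual form: the weight of a closed path is bounded by
a linear function of its length. -/
theorem exists_filling_bound (hXfin : X.Finite) (hhyp : IsRelHyperbolic H) :
    ∃ K : ℝ, 0 ≤ K ∧ ∀ (a b : G → ℝ) (β : Λ → G → ℝ), IsApproxPrimitive H X a b β →
      ∀ n s g, WeightedChain (EdgeWeight H X a b β) n s g g → |s| ≤ K * (n + 1) := by
  obtain ⟨Y, R, hpres, A, B, hiso⟩ := hhyp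
  have hword : ∀ y : G, ∃ w : List (RelLetter H Y), relEps H Y (wordToF w) = y := fun y => by
    obtain ⟨f, hf⟩ := hpres.surj y
    obtain ⟨w, rfl⟩ := wordToF_surjective Y f
    exact ⟨w, hf⟩
  choose word hword using hword
  choose N hN using exists_derivation_bound (H := H) (X := X) (Y := Y)
  have hfin : {y : G | y ∈ X ∨ y⁻¹ ∈ X}.Finite := by
    refine (hXfin.union (hXfin.image fun y => y⁻¹)).subset ?_
    rintro y (hy | hy)
    exacts [Or.inl hy, Or.inr ⟨_, hy, inv_inv y⟩]
  obtain ⟨C, hC, hCX⟩ := exists_forall_le_of_finite hfin fun y => ((word y).length : ℝ)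
  obtain ⟨M, hM, hMX⟩ := exists_forall_le_of_finite hfin fun y => N (wordToF (word y))
  obtain ⟨E, hE, hER⟩ := exists_forall_le_of_finite hpres.finR N
  refine ⟨M + E * (A * (C + 1)) + E * B, by positivity, fun a b β hab n s g hs => ?_⟩
  obtain ⟨D, hD⟩ := exists_isDerivation Y a b β
  have key : ∀ {n s g h}, WeightedChain (EdgeWeight H X a b β) n s g h →
      ∃ w : List (RelLetter H Y), (w.length : ℝ) ≤ (C + 1) * n ∧
        g * relEps H Y (wordToF w) = h ∧ |D (wordToF w) g - s| ≤ M * n := by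
    intro n s g h hs
    induction hs with
    | nil g => exact ⟨[], by simp, by simp [wordToF], by simp [wordToF, hD.one]⟩
    | @snoc n s t g h k _ ht ih =>
      obtain ⟨w, hlen, hval, hw⟩ := ih
      have hstep : ∃ v : List (RelLetter H Y), (v.length : ℝ) ≤ C + 1 ∧
          relEps H Y (wordToF v) = h⁻¹ * k ∧ |D (wordToF v) h - t| ≤ M := by
        rcases ht with ⟨hX, rfl⟩ | ⟨l, hl, rfl⟩
        · refine ⟨word (h⁻¹ * k), (hCX _ hX).trans (by linarith), hword _, ?_⟩
          have := hN (wordToF (word (h⁻¹ * k))) a b β D hab hD h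
          rw [hword, mul_inv_cancel_left] at this
          exact this.trans (hMX _ hX)
        · by_cases h1 : h⁻¹ * k = 1
          · refine ⟨[], by simpa using by linarith, by simp [wordToF, h1], ?_⟩
            obtain rfl : h = k := inv_mul_eq_one.1 h1
            simpa [wordToF, hD.one] using hM
          · refine ⟨[Sum.inl ⟨l, ⟨h⁻¹ * k, hl⟩, fun h' => h1 (congrArg Subtype.val h')⟩],
              by simpa using by linarith, ?_, ?_⟩
            · simp [wordToF, RelLetter.toF, relEps]
            · simpa [wordToF, RelLetter.toF, hD.of_subgroup] using hM
      obtain ⟨v, hvlen, hvval, hv⟩ := hstep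
      have happ : wordToF (w ++ v) = wordToF w * wordToF v := by simp [wordToF]
      refine ⟨w ++ v, ?_, ?_, ?_⟩
      · rw [List.length_append]
        push_cast
        linarith
      · rw [happ, map_mul, ← mul_assoc, hval, hvval, mul_inv_cancel_left]
      · rw [happ, hD.mul, hval]
        push_cast
        rw [abs_le] at *
        constructor <;> linarith [hw.1, hw.2, hv.1, hv.2]
  obtain ⟨w, hlen, hval, hw⟩ := key hs
  obtain ⟨k, hk, r, c, hr, hprod⟩ := hiso w (mul_eq_left.1 hval)
  have hrel : ∀ i, relEps H Y (r i) = 1 := fun i =>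
    MonoidHom.mem_ker.1 (hpres.ker ▸ Subgroup.subset_normalClosure (hr i))
  have hbound := hD.abs_prod_le (N := E) (List.ofFn fun i => (c i)⁻¹ * r i * c i) (by
    intro f hf
    obtain ⟨i, rfl⟩ := List.mem_ofFn.1 hf
    refine ⟨by simp [hrel i], fun g => ?_⟩
    rw [hD.conj (hrel i)]
    have := hN (r i) a b β D hab hD (g * (relEps H Y (c i))⁻¹)
    rw [hrel i, mul_one, sub_self, mul_zero, sub_zero] at this
    exact this.trans (hER _ (hr i))) g
  rw [← hprod, List.length_ofFn] at hbound
  have hk' : (k : ℝ) ≤ A * w.length + B := by exact_mod_cast hk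
  have h₁ : E * (k : ℝ) ≤ E * (A * ((C + 1) * n) + B) := by gcongr; exact hk'.trans (by gcongr)
  have h₂ : 0 ≤ M + E * (A * (C + 1)) + E * B * n := by positivity
  rw [abs_le] at *
  constructor <;> linarith [hw.1, hw.2, hbound.1, hbound.2]

end Filling

section Isolated

variable {G : Type*} [Group G] {Λ : Type*} {H : Λ → Subgroup G} {X : Set G}

/-- Adjacency (or equality) in the Cayley graph `Γ(G, X ∪ 𝓗)`. -/
def Step (H : Λ → Subgroup G) (X : Set G) (g h : G) : Prop :=
  (g⁻¹ * h ∈ X ∨ (g⁻¹ * h)⁻¹ ∈ X) ∨ ∃ l, g⁻¹ * h ∈ H l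

/-- Adjacency along an edge which is not an `H l`-edge of the coset `x H l`. -/
def AvoidStep (H : Λ → Subgroup G) (X : Set G) (l : Λ) (x g h : G) : Prop :=
  (g⁻¹ * h ∈ X ∨ (g⁻¹ * h)⁻¹ ∈ X) ∨ ∃ l', g⁻¹ * h ∈ H l' ∧ (l' = l → x⁻¹ * g ∉ H l)

theorem mul_inv_mul_mem_iff {K : Subgroup G} {x g h : G} (hgh : g⁻¹ * h ∈ K) :
    x⁻¹ * h ∈ K ↔ x⁻¹ * g ∈ K := by
  rw [show x⁻¹ * h = x⁻¹ * g * (g⁻¹ * h) by group, K.mul_mem_cancel_right hgh]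

theorem Step.symm {g h : G} (hs : Step H X g h) : Step H X h g := by
  rcases hs with hs | ⟨l, hl⟩
  · refine Or.inl ?_
    simpa [or_comm] using hs
  · exact Or.inr ⟨l, by simpa using (H l).inv_mem hl⟩

theorem AvoidStep.symm {l : Λ} {x g h : G} (hs : AvoidStep H X l x g h) :
    AvoidStep H X l x h g := by
  rcases hs with hs | ⟨l', hl', hne⟩
  · refine Or.inl ?_
    simpa [or_comm] using hs
  · refine Or.inr ⟨l', by simpa using (H l').inv_mem hl', ?_⟩
    rintro rfl
    rw [mul_inv_mul_mem_iff hl']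
    exact hne rfl

theorem AvoidStep.step {l : Λ} {x g h : G} (hs : AvoidStep H X l x g h) : Step H X g h :=
  hs.imp id fun ⟨l', hl', _⟩ => ⟨l', hl'⟩

/-- Two points of a coset of `H l` which are joined by a path of length `n` without
`H l`-edges in this coset are close for `dist_X`. -/
theorem exists_isolated_bound (hXfin : X.Finite) (hXgen : Subgroup.closure X = ⊤)
    (hhyp : IsRelHyperbolic H) :
    ∃ K : ℝ, 0 ≤ K ∧ ∀ l (x y : G) n, x⁻¹ * y ∈ H l → Chain (AvoidStep H X l x) n x y →
      (xDist X x y : ℝ) ≤ K * (n + 2) := by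
  classical
  obtain ⟨K, hK, hbound⟩ := exists_filling_bound hXfin hhyp
  refine ⟨K, hK, fun l x y n hxy hchain => ?_⟩
  let β : Λ → G → ℝ := fun l' z => if l' = l ∧ x⁻¹ * z ∈ H l then xDist X x z else 0
  have hβ : IsApproxPrimitive H X 0 0 β := by
    refine ⟨by simp, by simp, fun l' g h hh => ?_⟩
    by_cases hg : l' = l ∧ x⁻¹ * g ∈ H l
    · obtain ⟨rfl, hg⟩ := hg
      have hgh : x⁻¹ * (g * h) ∈ H l' := by
        rw [← mul_assoc]
        exact mul_mem hg hh
      have := abs_sub_xDist_le hXgen x g (g * h)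
      simp only [xDist, inv_mul_cancel_left] at this
      simp only [β, hg, hgh, and_self, if_true, Pi.zero_apply, zero_mul, sub_zero, xDist]
      linarith
    · have hgh : ¬(l' = l ∧ x⁻¹ * (g * h) ∈ H l) := by
        rintro ⟨rfl, hgh⟩
        refine hg ⟨rfl, ?_⟩
        rwa [← mul_assoc, (H l').mul_mem_cancel_right hh] at hgh
      simp only [β, hg, hgh, if_false, Pi.zero_apply, zero_mul, sub_zero, abs_zero]
      positivity
  have hzero : ∀ {n g h}, Chain (AvoidStep H X l x) n g h →
      WeightedChain (EdgeWeight H X 0 0 β) n 0 g h := by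
    intro n g h hgh
    induction hgh with
    | nil => exact .nil _
    | @snoc n g h k _ hs ih =>
      rw [show (0 : ℝ) = 0 + 0 by simp]
      refine ih.snoc ?_
      rcases hs with hs | ⟨l', hl', hne⟩
      · exact Or.inl ⟨hs, by simp⟩
      · refine Or.inr ⟨l', hl', ?_⟩
        have h₁ : ¬(l' = l ∧ x⁻¹ * h ∈ H l) := fun h' => hne h'.1 h'.2
        have h₂ : ¬(l' = l ∧ x⁻¹ * k ∈ H l) := by
          rintro ⟨rfl, hk⟩
          exact hne rfl ((mul_inv_mul_mem_iff hl').1 hk)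
        simp [β, h₁, h₂]
  have hclosed := hbound 0 0 β hβ (n + 1) _ x
    ((hzero hchain).snoc (Or.inr ⟨l, by simpa using (H l).inv_mem hxy, rfl⟩))
  simp only [β, hxy, inv_mul_cancel, one_mem, and_self, if_true, xDist_self] at hclosed
  rw [abs_le] at hclosed
  push_cast at hclosed
  linarith [hclosed.1]

end Isolated

section Paths

variable {G : Type*} [Group G] {Λ : Type*} {H : Λ → Subgroup G} {X : Set G}

theorem chain_wordLength {S : Set G} (hS : Subgroup.closure S = ⊤) (g h : G) :
    Chain (fun g h => g⁻¹ * h ∈ S ∨ (g⁻¹ * h)⁻¹ ∈ S) (wordLength S (g⁻¹ * h)) g h := by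
  have key : ∀ (w : List G) (g : G), (∀ x ∈ w, x ∈ S ∨ x⁻¹ ∈ S) →
      Chain (fun g h => g⁻¹ * h ∈ S ∨ (g⁻¹ * h)⁻¹ ∈ S) w.length g (g * w.prod) := by
    intro w
    induction w with
    | nil => simpa using fun g => Chain.nil g
    | cons x w ih =>
      intro g hw
      rw [List.prod_cons, ← mul_assoc, List.length_cons, add_comm]
      refine Chain.trans ((Chain.nil g).snoc ?_) (ih (g * x) fun y hy => hw y (by simp [hy]))
      simpa using hw x (by simp)
  obtain ⟨w, hlen, hw, hprod⟩ := exists_word_length_eq hS (g⁻¹ * h)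
  simpa [hlen, hprod] using key w g hw

theorem chain_xDist (hX : Subgroup.closure X = ⊤) (g h : G) :
    Chain (fun g h => g⁻¹ * h ∈ X ∨ (g⁻¹ * h)⁻¹ ∈ X) (xDist X g h) g h :=
  chain_wordLength hX g h

theorem chain_relDist (hX : Subgroup.closure X = ⊤) (g h : G) :
    Chain (Step H X) (relDist H X g h) g h := by
  refine (chain_wordLength (closure_union_eq_top hX) g h).mono ?_
  rintro g h ((hs | hs) | (hs | hs))
  · exact Or.inl (Or.inl hs)
  · exact Or.inr (Set.mem_iUnion.1 hs)
  · exact Or.inl (Or.inr hs)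
  · obtain ⟨l, hl⟩ := Set.mem_iUnion.1 hs
    exact Or.inr ⟨l, by simpa using (H l).inv_mem hl⟩

theorem Step.relDist_le_one {g h : G} (hs : Step H X g h) : relDist H X g h ≤ 1 := by
  rcases hs with hs | ⟨l, hl⟩
  · exact wordLength_le_one (hs.imp Or.inl Or.inl)
  · exact relDist_le_one_of_mem hl

theorem Chain.relDist_le (hX : Subgroup.closure X = ⊤) {n : ℕ} {g h : G}
    (hgh : Chain (Step H X) n g h) : relDist H X g h ≤ n := by
  induction hgh with
  | nil => simp
  | snoc _ hs ih => exact (relDist_triangle hX _ _ _).trans (add_le_add ih hs.relDist_le_one)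

namespace RelPath

variable (p : RelPath H X)

@[simp]
theorem vertex_zero : p.vertex 0 = p.start := by simp [vertex]

theorem vertex_succ {m : ℕ} (hm : m < p.len) :
    p.vertex (m + 1) = p.vertex m * (p.word[m]'hm).val := by
  have : p.word.take (m + 1) = p.word.take m ++ [p.word[m]'hm] := by
    rw [List.take_add_one, List.getElem?_eq_getElem hm, Option.toList_some]
  simp [vertex, this, mul_assoc]

theorem edge {m : ℕ} (hm : m < p.len) :
    ((p.vertex m)⁻¹ * p.vertex (m + 1) ∈ X ∨ ((p.vertex m)⁻¹ * p.vertex (m + 1))⁻¹ ∈ X) ∨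
      ∃ l, (p.vertex m)⁻¹ * p.vertex (m + 1) ∈ H l ∧ LetterIsH p l m := by
  rw [vertex_succ p hm, inv_mul_cancel_left]
  have hlet : p.word[m]? = some (p.word[m]'hm) := List.getElem?_eq_getElem hm
  rcases ha : p.word[m]'hm with ⟨l, h⟩ | ⟨x, b⟩
  · exact Or.inr ⟨l, h.1.2, _, hlet, by rw [ha]; rfl⟩
  · left
    cases b <;> simp [RelLetter.val]

theorem step {m : ℕ} (hm : m < p.len) : Step H X (p.vertex m) (p.vertex (m + 1)) :=
  (p.edge hm).imp id fun ⟨l, hl, _⟩ => ⟨l, hl⟩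

theorem avoidStep {l : Λ} {x : G} {m : ℕ} (hm : m < p.len)
    (h : LetterIsH p l m → x⁻¹ * p.vertex m ∉ H l) :
    AvoidStep H X l x (p.vertex m) (p.vertex (m + 1)) :=
  (p.edge hm).imp id fun ⟨l', hl', hlet⟩ => ⟨l', hl', fun hll => h (hll ▸ hlet)⟩

end RelPath

theorem LetterIsH.lt_len {p : RelPath H X} {l : Λ} {m : ℕ} (h : LetterIsH p l m) : m < p.len := by
  obtain ⟨a, ha, _⟩ := h
  exact (List.getElem?_eq_some_iff.1 ha).1

theorem LetterIsH.unique {p : RelPath H X} {l l' : Λ} {m : ℕ} (h : LetterIsH p l m)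
    (h' : LetterIsH p l' m) : l = l' := by
  obtain ⟨a, ha, hl⟩ := h
  obtain ⟨a', ha', hl'⟩ := h'
  obtain rfl : a = a' := Option.some.inj (ha.symm.trans ha')
  exact Option.some.inj (hl.symm.trans hl')

theorem LetterIsH.mem {p : RelPath H X} {l : Λ} {m : ℕ} (h : LetterIsH p l m) :
    (p.vertex m)⁻¹ * p.vertex (m + 1) ∈ H l := by
  have hm := h.lt_len
  obtain ⟨a, ha, hl⟩ := h
  rw [p.vertex_succ hm, inv_mul_cancel_left]
  have : p.word[m]'hm = a := (List.getElem?_eq_some_iff.1 ha).2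
  rw [this]
  rcases a with ⟨l', h⟩ | ⟨x, b⟩
  · obtain rfl : l' = l := Option.some.inj hl
    exact h.1.2
  · simp [RelLetter.hIndex] at hl

theorem IsQuasiGeodesic.sub_le (hX : Subgroup.closure X = ⊤) {lam c : ℝ}
    {p : RelPath H X} (hp : IsQuasiGeodesic lam c p) {i j : ℕ} (hi : i ≤ p.len)
    (hj : j ≤ p.len) :
    (((j - i) + (i - j) : ℕ) : ℝ) ≤ lam * relDist H X (p.vertex i) (p.vertex j) + c := by
  rcases le_total i j with hij | hij
  · simpa [Nat.sub_eq_zero_of_le hij] using hp i j hij hj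
  · rw [relDist_comm hX]
    simpa [Nat.sub_eq_zero_of_le hij] using hp j i hij hi

end Paths

section Stability

variable {G : Type*} [Group G] {Λ : Type*} {H : Λ → Subgroup G} {X : Set G}

/-- The weight `a db` of an edge of the Cayley graph. -/
def FormWeight (H : Λ → Subgroup G) (X : Set G) (a b : G → ℝ) (g h : G) (t : ℝ) : Prop :=
  Step H X g h ∧ t = a g * (b h - b g)

/-- The integral of `a db` over a closed path is bounded by a linear function of its length. -/
theorem exists_form_bound (hXfin : X.Finite) (hXgen : Subgroup.closure X = ⊤)
    (hhyp : IsRelHyperbolic H) :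
    ∃ K : ℝ, 0 ≤ K ∧ ∀ a b : G → ℝ, (∀ g h, |a h - a g| ≤ relDist H X g h) →
      (∀ g h, |b h - b g| ≤ relDist H X g h) →
      ∀ n s g, WeightedChain (FormWeight H X a b) n s g g → |s| ≤ K * (n + 1) := by
  obtain ⟨K, hK, hbound⟩ := exists_filling_bound hXfin hhyp
  refine ⟨K + 1, by positivity, fun a b ha hb n s g hs => ?_⟩
  let β : Λ → G → ℝ := fun l y => a (y : G ⧸ H l).out * b y
  have hclose : ∀ l g h, g⁻¹ * h ∈ H l → |β l h - β l g - a g * (b h - b g)| ≤ 1 := by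
    intro l g h hgh
    have hout : ((h : G ⧸ H l)).out = ((g : G ⧸ H l)).out :=
      congrArg Quotient.out (QuotientGroup.eq.2 hgh).symm
    have h₁ : |a (g : G ⧸ H l).out - a g| ≤ 1 := by
      refine (ha _ _).trans ?_
      have : g⁻¹ * (g : G ⧸ H l).out ∈ H l :=
        QuotientGroup.eq.1 (QuotientGroup.out_eq' (g : G ⧸ H l)).symm
      exact_mod_cast relDist_le_one_of_mem this
    have h₂ : |b h - b g| ≤ 1 := (hb _ _).trans (by exact_mod_cast relDist_le_one_of_mem hgh)
    have : β l h - β l g - a g * (b h - b g) = (a (g : G ⧸ H l).out - a g) * (b h - b g) := by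
      simp only [β, hout]
      ring
    rw [this, abs_mul]
    exact mul_le_one₀ h₁ (abs_nonneg _) h₂
  have hlip : ∀ g h : G, (relDist H X g (g * h) : ℝ) ≤ wordLength X h := fun g h => by
    have := relDist_le_xDist (H := H) hXgen g (g * h)
    rw [xDist, inv_mul_cancel_left] at this
    exact_mod_cast this
  have hβ : IsApproxPrimitive H X a b β := by
    refine ⟨fun g h => (ha _ _).trans (hlip g h), fun g h => (hb _ _).trans (hlip g h),
      fun l g h hh => (hclose l g (g * h) (by simpa using hh)).trans ?_⟩
    simp
  have key : ∀ {n s g h}, WeightedChain (FormWeight H X a b) n s g h →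
      ∃ s', WeightedChain (EdgeWeight H X a b β) n s' g h ∧ |s' - s| ≤ n := by
    intro n s g h hs
    induction hs with
    | nil g => exact ⟨0, .nil g, by simp⟩
    | @snoc n s t g h k _ ht ih =>
      obtain ⟨s', hs', hle⟩ := ih
      obtain ⟨t', ht', hle'⟩ : ∃ t', EdgeWeight H X a b β h k t' ∧ |t' - t| ≤ 1 := by
        obtain ⟨hX | ⟨l, hl⟩, rfl⟩ := ht
        · exact ⟨_, Or.inl ⟨hX, rfl⟩, by simp⟩
        · exact ⟨_, Or.inr ⟨l, hl, rfl⟩, hclose l h k hl⟩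
      refine ⟨s' + t', hs'.snoc ht', ?_⟩
      push_cast
      rw [abs_le] at *
      constructor <;> linarith [hle.1, hle.2, hle'.1, hle'.2]
  obtain ⟨s', hs', hle⟩ := key hs
  have := hbound a b β hβ n s' g hs'
  rw [abs_le] at *
  constructor <;> linarith [hle.1, hle.2, this.1, this.2]

theorem Chain.weightedChain_const {a b : G → ℝ} {α : ℝ} {n : ℕ} {g h : G}
    (hgh : Chain (fun g h => Step H X g h ∧ a g = α ∧ a h = α) n g h) :
    WeightedChain (FormWeight H X a b) n (α * (b h - b g)) g h := by
  induction hgh with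
  | nil g => simpa using WeightedChain.nil g
  | @snoc n g h k _ hs ih =>
    rw [show α * (b k - b g) = α * (b h - b g) + α * (b k - b h) by ring]
    exact ih.snoc ⟨hs.1, by rw [hs.2.1]⟩

theorem Chain.exists_weightedChain {a b : G → ℝ} {A : ℝ} (ha : ∀ g, |a g| ≤ A)
    (hb : ∀ g h, |b h - b g| ≤ relDist H X g h) {n : ℕ} {g h : G}
    (hgh : Chain (Step H X) n g h) :
    ∃ s, WeightedChain (FormWeight H X a b) n s g h ∧ |s| ≤ A * n := by
  induction hgh with
  | nil g => exact ⟨0, .nil g, by simp⟩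
  | @snoc n g h k _ hs ih =>
    obtain ⟨s, hs', hle⟩ := ih
    refine ⟨_, hs'.snoc ⟨hs, rfl⟩, (abs_add_le _ _).trans ?_⟩
    have h₁ : |a h * (b k - b h)| ≤ A * 1 := by
      rw [abs_mul]
      exact mul_le_mul (ha h) ((hb h k).trans (by exact_mod_cast hs.relDist_le_one))
        (abs_nonneg _) ((abs_nonneg _).trans (ha h))
    push_cast
    linarith

/-- Quasi-geodesics with close endpoints stay close to each other in `Γ(G, X ∪ 𝓗)`. -/
theorem exists_stability_bound (hXfin : X.Finite) (hXgen : Subgroup.closure X = ⊤)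
    (hhyp : IsRelHyperbolic H) {lam c k : ℝ} (hlam : 1 ≤ lam) :
    ∃ D : ℕ, ∀ p q : RelPath H X, IsQuasiGeodesic lam c p → IsQuasiGeodesic lam c q →
      Similar k p q → ∀ i ≤ p.len, ∃ j ≤ q.len,
        relDist H X (p.vertex i) (q.vertex j) ≤ D := by
  classical
  obtain ⟨K, hK, hbound⟩ := exists_form_bound hXfin hXgen hhyp
  obtain ⟨D, hD⟩ := exists_nat_ge (max k (2 * K * lam + 1))
  have hkD : k ≤ D := (le_max_left _ _).trans hD
  have hKD : 2 * K * lam + 1 ≤ D := (le_max_right _ _).trans hD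
  set E : ℝ := 2 * D * D + K * (2 * lam * D + 2 * c + 2 * D + 1) with hE
  obtain ⟨F, hF⟩ := exists_nat_ge (lam * (E + 2 * D) + c)
  refine ⟨F + D, fun p q hp hq hpq i hi => ?_⟩
  let near : ℕ → Prop := fun i => ∃ j ≤ q.len, relDist H X (p.vertex i) (q.vertex j) ≤ D
  have hnear_zero : near 0 := by
    refine ⟨0, Nat.zero_le _, (relDist_le_xDist hXgen _ _).trans ?_⟩
    simpa using (Nat.cast_le (α := ℝ)).1 (hpq.1.trans hkD)
  have hnear_len : near p.len := by
    refine ⟨q.len, le_rfl, (relDist_le_xDist hXgen _ _).trans ?_⟩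
    exact (Nat.cast_le (α := ℝ)).1 (hpq.2.trans hkD)
  by_cases hni : near i
  · obtain ⟨j, hj, hij⟩ := hni
    exact ⟨j, hj, hij.trans (by omega)⟩
  obtain ⟨i₁, hi₁, hn₁, hmax⟩ : ∃ i₁ < i, near i₁ ∧ ∀ m, i₁ < m → m ≤ i → ¬near m := by
    refine ⟨Nat.findGreatest near i, ?_, Nat.findGreatest_spec (Nat.zero_le i) hnear_zero,
      fun m h₁ h₂ => Nat.findGreatest_is_greatest h₁ h₂⟩
    refine lt_of_le_of_ne (Nat.findGreatest_le i) fun h => hni ?_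
    have := Nat.findGreatest_spec (P := near) (Nat.zero_le i) hnear_zero
    rwa [h] at this
  obtain ⟨i₂, hi₂, hi₂len, hn₂, hmin⟩ : ∃ i₂, i < i₂ ∧ i₂ ≤ p.len ∧ near i₂ ∧
      ∀ m, i ≤ m → m < i₂ → ¬near m := by
    have hex : ∃ m, i ≤ m ∧ near m := ⟨p.len, hi, hnear_len⟩
    refine ⟨Nat.find hex, lt_of_le_of_ne (Nat.find_spec hex).1 fun h => hni ?_,
      Nat.find_min' hex ⟨hi, hnear_len⟩, (Nat.find_spec hex).2,
      fun m h₁ h₂ hm => Nat.find_min hex h₂ ⟨h₁, hm⟩⟩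
    have := (Nat.find_spec hex).2
    rwa [← h] at this
  have hfar : ∀ m, i₁ < m → m < i₂ → ¬near m := fun m h₁ h₂ =>
    (le_total m i).elim (hmax m h₁) fun h => hmin m h h₂
  obtain ⟨j₁, hj₁, hd₁⟩ := hn₁
  obtain ⟨j₂, hj₂, hd₂⟩ := hn₂
  let dq : G → ℕ := fun g => sInf {n | ∃ j ≤ q.len, relDist H X g (q.vertex j) = n}
  have hdq_le : ∀ g j, j ≤ q.len → dq g ≤ relDist H X g (q.vertex j) := fun g j hj =>
    Nat.sInf_le ⟨j, hj, rfl⟩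
  have hdq_mem : ∀ g, ∃ j ≤ q.len, relDist H X g (q.vertex j) = dq g := fun g =>
    Nat.sInf_mem (s := {n | ∃ j ≤ q.len, relDist H X g (q.vertex j) = n})
      ⟨_, 0, Nat.zero_le _, rfl⟩
  have hdq_lip : ∀ g h, dq g ≤ relDist H X g h + dq h := fun g h => by
    obtain ⟨j, hj, hjd⟩ := hdq_mem h
    rw [← hjd]
    exact (hdq_le g j hj).trans (relDist_triangle hXgen _ _ _)
  have hdq_far : ∀ m, i₁ < m → m < i₂ → D < dq (p.vertex m) := fun m h₁ h₂ => by
    obtain ⟨j, hj, hjd⟩ := hdq_mem (p.vertex m)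
    by_contra! h
    exact hfar m h₁ h₂ ⟨j, hj, hjd.trans_le h⟩
  have hdq_left : D ≤ dq (p.vertex i₁) := by
    have h₁ := hdq_far (i₁ + 1) (by omega) (by omega)
    have h₂ := hdq_lip (p.vertex (i₁ + 1)) (p.vertex i₁)
    have h₃ := (p.step (m := i₁) (by omega)).symm.relDist_le_one
    omega
  have hdq_right : D ≤ dq (p.vertex i₂) := by
    have h₁ := hdq_far (i₂ - 1) (by omega) (by omega)
    have h₂ := hdq_lip (p.vertex (i₂ - 1)) (p.vertex i₂)
    have h₃ := (p.step (m := i₂ - 1) (by omega)).relDist_le_one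
    rw [Nat.sub_add_cancel (by omega)] at h₃
    omega
  let a : G → ℝ := fun g => ((D - dq g : ℕ) : ℝ)
  let b : G → ℝ := fun g => relDist H X (q.vertex j₁) g
  have ha : ∀ g h, |a h - a g| ≤ relDist H X g h := fun g h => by
    have h₁ := hdq_lip g h
    have h₂ := hdq_lip h g
    rw [relDist_comm hXgen] at h₂
    have h₃ : D - dq h ≤ D - dq g + relDist H X g h := by omega
    have h₄ : D - dq g ≤ D - dq h + relDist H X g h := by omega
    have h₃' : a h ≤ a g + relDist H X g h := by
      change ((D - dq h : ℕ) : ℝ) ≤ ((D - dq g : ℕ) : ℝ) + _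
      exact_mod_cast h₃
    have h₄' : a g ≤ a h + relDist H X g h := by
      change ((D - dq g : ℕ) : ℝ) ≤ ((D - dq h : ℕ) : ℝ) + _
      exact_mod_cast h₄
    rw [abs_le]
    constructor <;> linarith
  have hb : ∀ g h, |b h - b g| ≤ relDist H X g h := fun g h => abs_sub_relDist_le hXgen _ g h
  have haD : ∀ g, |a g| ≤ D := fun g => by
    rw [abs_of_nonneg (Nat.cast_nonneg _)]
    change ((D - dq g : ℕ) : ℝ) ≤ D
    exact_mod_cast Nat.sub_le _ _
  have ha_p : ∀ m, i₁ ≤ m → m ≤ i₂ → a (p.vertex m) = 0 := fun m h₁ h₂ => by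
    have : D ≤ dq (p.vertex m) := by
      rcases h₁.eq_or_lt with rfl | h₁
      · exact hdq_left
      · rcases h₂.eq_or_lt with rfl | h₂
        · exact hdq_right
        · exact (hdq_far m h₁ h₂).le
    simp [a, Nat.sub_eq_zero_of_le this]
  have ha_q : ∀ j ≤ q.len, a (q.vertex j) = D := fun j hj => by
    have : dq (q.vertex j) = 0 := by simpa using hdq_le (q.vertex j) j hj
    simp [a, this]
  have hchain_p : WeightedChain (FormWeight H X a b) (i₂ - i₁)
      (0 * (b (p.vertex i₂) - b (p.vertex i₁))) (p.vertex i₁) (p.vertex i₂) :=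
    (Chain.of_fun p.vertex (by omega) fun m h₁ h₂ =>
      ⟨p.step (by omega), ha_p m h₁ h₂.le, ha_p (m + 1) (by omega) h₂⟩).weightedChain_const
  have hchain_q : WeightedChain (FormWeight H X a b) ((j₁ - j₂) + (j₂ - j₁))
      (D * (b (q.vertex j₁) - b (q.vertex j₂))) (q.vertex j₂) (q.vertex j₁) :=
    (Chain.of_fun_of_symm (fun g h hs => ⟨hs.1.symm, hs.2.2, hs.2.1⟩) q.vertex fun m _ h₂ =>
      ⟨q.step (by omega), ha_q m (by omega), ha_q (m + 1) (by omega)⟩).weightedChain_const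
  obtain ⟨s₂, hchain₂, hs₂⟩ := (chain_relDist (H := H) hXgen (p.vertex i₂)
    (q.vertex j₂)).exists_weightedChain haD hb
  obtain ⟨s₁, hchain₁, hs₁⟩ := (chain_relDist (H := H) hXgen (q.vertex j₁)
    (p.vertex i₁)).exists_weightedChain haD hb
  have hcycle := hbound a b ha hb _ _ _
    (((hchain_p.trans hchain₂).trans hchain_q).trans hchain₁)
  have hq' := hq.sub_le hXgen hj₂ hj₁
  have hp' := hp.sub_le hXgen (by omega : i₁ ≤ p.len) hi₂len
  set d := relDist H X (q.vertex j₂) (q.vertex j₁) with hd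
  have hb₁ : b (q.vertex j₁) = 0 := by simp [b]
  have hb₂ : b (q.vertex j₂) = d := by simp only [b, hd]; rw [relDist_comm hXgen]
  rw [relDist_comm hXgen (q.vertex j₁)] at hs₁ hcycle
  have hpd : relDist H X (p.vertex i₁) (p.vertex i₂) ≤ D + d + D := by
    have h₁ := relDist_triangle (H := H) hXgen (p.vertex i₁) (q.vertex j₁) (p.vertex i₂)
    have h₂ := relDist_triangle (H := H) hXgen (q.vertex j₁) (q.vertex j₂) (p.vertex i₂)
    rw [relDist_comm hXgen (q.vertex j₂) (p.vertex i₂),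
      relDist_comm hXgen (q.vertex j₁) (q.vertex j₂)] at h₂
    omega
  have hpd' : (relDist H X (p.vertex i₁) (p.vertex i₂) : ℝ) ≤ D + d + D := by exact_mod_cast hpd
  have hd₁' : (relDist H X (p.vertex i₁) (q.vertex j₁) : ℝ) ≤ D := by exact_mod_cast hd₁
  have hd₂' : (relDist H X (p.vertex i₂) (q.vertex j₂) : ℝ) ≤ D := by exact_mod_cast hd₂
  rw [Nat.sub_eq_zero_of_le (by omega : i₁ ≤ i₂), add_zero] at hp'
  rw [hb₁, hb₂] at hcycle
  have hD0 : (0 : ℝ) ≤ D := Nat.cast_nonneg D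
  have hs₁' : |s₁| ≤ D * D := hs₁.trans (by gcongr)
  have hs₂' : |s₂| ≤ D * D := hs₂.trans (by gcongr)
  have hlen : ((i₂ - i₁ : ℕ) : ℝ) ≤ lam * (D + d + D) + c :=
    hp'.trans (by gcongr)
  have hd_le : (d : ℝ) ≤ E := by
    have h₁ : (D : ℝ) * d ≤ 2 * D * D + K * ((lam * (D + d + D) + c) + D + (lam * d + c) + D + 1) := by
      have h₂ : |0 * (b (p.vertex i₂) - b (p.vertex i₁)) + s₂ + D * (0 - d) + s₁| ≤
          K * ((lam * (D + d + D) + c) + D + (lam * d + c) + D + 1) := by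
        refine hcycle.trans ?_
        push_cast at hq' ⊢
        gcongr
      rw [abs_le] at h₂ hs₁' hs₂'
      linarith [h₂.1, hs₁'.2, hs₂'.2]
    have h₂ := mul_le_mul_of_nonneg_right hKD (Nat.cast_nonneg (α := ℝ) d)
    rw [hE]
    linarith
  have hiF : i - i₁ ≤ F := by
    have : ((i₂ - i₁ : ℕ) : ℝ) ≤ F := hlen.trans (le_trans (by nlinarith) hF)
    have : i₂ - i₁ ≤ F := by exact_mod_cast this
    omega
  refine ⟨j₁, hj₁, (relDist_triangle hXgen _ (p.vertex i₁) _).trans (add_le_add ?_ hd₁)⟩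
  rw [relDist_comm hXgen]
  exact ((Chain.of_fun p.vertex hi₁.le fun m _ h₂ => p.step (by omega)).relDist_le hXgen).trans hiF

end Stability

section Components

variable {G : Type*} [Group G] {Λ : Type*} {H : Λ → Subgroup G} {X : Set G}
  {p : RelPath H X} {l : Λ} {a b m : ℕ}

theorem LetterIsH.exists_isComponent (h : LetterIsH p l m) :
    ∃ a b, IsComponent p l a b ∧ a ≤ m ∧ m ≤ b := by
  classical
  have hex : ∃ a, a ≤ m ∧ ∀ k, a ≤ k → k ≤ m → LetterIsH p l k :=
    ⟨m, le_rfl, fun k h₁ h₂ => le_antisymm h₁ h₂ ▸ h⟩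
  let Q : ℕ → Prop := fun b => m ≤ b ∧ ∀ k, m ≤ k → k ≤ b → LetterIsH p l k
  have hQm : Q m := ⟨le_rfl, fun k h₁ h₂ => le_antisymm h₁ h₂ ▸ h⟩
  obtain ⟨hmb, hb⟩ : Q (Nat.findGreatest Q p.len) :=
    Nat.findGreatest_spec h.lt_len.le hQm
  obtain ⟨ham, ha⟩ := Nat.find_spec hex
  refine ⟨Nat.find hex, Nat.findGreatest Q p.len, ⟨ham.trans hmb, (hb _ hmb le_rfl).lt_len,
    fun k h₁ h₂ => (le_total k m).elim (ha k h₁) fun h => hb k h h₂, ?_, Or.inr ?_⟩, ham, hmb⟩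
  · refine or_iff_not_imp_left.2 fun h₀ hlet => Nat.find_min hex
      (Nat.sub_lt (Nat.pos_of_ne_zero h₀) Nat.one_pos) ⟨by omega, fun k h₁ h₂ => ?_⟩
    rcases h₁.eq_or_lt with rfl | h₁
    · exact hlet
    · exact ha k (by omega) h₂
  · intro hlet
    refine Nat.findGreatest_is_greatest (Nat.lt_succ_self _) hlet.lt_len.le
      ⟨by omega, fun k h₁ h₂ => ?_⟩
    rcases h₂.eq_or_lt with rfl | h₂
    · exact hlet
    · exact hb k h₁ (by omega)

theorem IsComponent.mem (h : IsComponent p l a b) (ham : a ≤ m) (hmb : m ≤ b + 1) :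
    (p.vertex a)⁻¹ * p.vertex m ∈ H l := by
  induction m, ham using Nat.le_induction with
  | base => simp
  | succ m ham ih =>
    have := (H l).mul_mem (ih (by omega)) (h.2.2.1 m ham (by omega)).mem
    rwa [mul_assoc, mul_inv_cancel_left] at this

theorem IsComponent.mem_iff (h : IsComponent p l a b) (ham : a ≤ m) (hmb : m ≤ b + 1) (x : G) :
    x⁻¹ * p.vertex m ∈ H l ↔ x⁻¹ * p.vertex a ∈ H l :=
  mul_inv_mul_mem_iff (h.mem ham hmb)

theorem IsComponent.isPhase_left (h : IsComponent p l a b) : IsPhase p a := by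
  rintro ⟨l', a', b', h', ha, hb⟩
  obtain rfl := (h.2.2.1 a le_rfl h.1).unique (h'.2.2.1 a ha.le hb)
  exact h.2.2.2.1.elim (by omega) fun hn => hn (h'.2.2.1 (a - 1) (by omega) (by omega))

theorem IsComponent.isPhase_right (h : IsComponent p l a b) : IsPhase p (b + 1) := by
  rintro ⟨l', a', b', h', ha, hb⟩
  obtain rfl := (h.2.2.1 b h.1 le_rfl).unique (h'.2.2.1 b (by omega) (by omega))
  have := h'.2.1
  exact h.2.2.2.2.elim (by omega) fun hn => hn (h'.2.2.1 (b + 1) ha.le hb)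

theorem isPhase_zero (p : RelPath H X) : IsPhase p 0 := by
  rintro ⟨l, a, b, -, ha, -⟩
  omega

theorem isPhase_len (p : RelPath H X) : IsPhase p p.len := by
  rintro ⟨l, a, b, h, -, hb⟩
  exact hb.not_gt h.2.1

theorem exists_isPhase_near (hm : m ≤ p.len) :
    ∃ v ≤ p.len, IsPhase p v ∧ relDist H X (p.vertex m) (p.vertex v) ≤ 1 := by
  by_cases h : IsPhase p m
  · exact ⟨m, hm, h, by simp⟩
  · obtain ⟨l, a, b, hcomp, ha, hb⟩ := not_not.1 h
    refine ⟨a, by omega, hcomp.isPhase_left, relDist_le_one_of_mem (l := l) ?_⟩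
    simpa using (H l).inv_mem (hcomp.mem ha.le (by omega))

/-- A phase vertex can be joined to a coset along the path without using edges of the coset. -/
theorem exists_chain_to_coset {j : ℕ} {x : G} (hj : j ≤ p.len) (hjp : IsPhase p j)
    (hex : ∃ t ≤ p.len, IsPhase p t ∧ x⁻¹ * p.vertex t ∈ H l) :
    ∃ t ≤ p.len, IsPhase p t ∧ x⁻¹ * p.vertex t ∈ H l ∧
      Chain (AvoidStep H X l x) ((t - j) + (j - t)) (p.vertex j) (p.vertex t) := by
  obtain ⟨t, ⟨ht, htp, hxt⟩, hmin⟩ := (measure fun t => (t - j) + (j - t)).wf.has_min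
    {t | t ≤ p.len ∧ IsPhase p t ∧ x⁻¹ * p.vertex t ∈ H l} hex
  have hmin' : ∀ s ≤ p.len, IsPhase p s → x⁻¹ * p.vertex s ∈ H l →
      (t - j) + (j - t) ≤ (s - j) + (j - s) := fun s h₁ h₂ h₃ => not_lt.1 (hmin s ⟨h₁, h₂, h₃⟩)
  refine ⟨t, ht, htp, hxt, Chain.of_fun_of_symm (fun _ _ h => h.symm) p.vertex
    fun m h₁ h₂ => p.avoidStep (by omega) fun hlet hxm => ?_⟩
  obtain ⟨a, b, hcomp, ha, hb⟩ := hlet.exists_isComponent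
  have hxa := (hcomp.mem_iff ha (by omega) x).1 hxm
  have hxb := (hcomp.mem_iff (hcomp.1.trans b.le_succ) le_rfl x).2 hxa
  have hblen := hcomp.2.1
  have hj' : ¬(a < j ∧ j ≤ b) := fun h => hjp ⟨l, a, b, hcomp, h⟩
  have hmin_a := hmin' a (by omega) hcomp.isPhase_left hxa
  have hmin_b := hmin' (b + 1) hblen hcomp.isPhase_right hxb
  omega

/-- A path without phase vertices in a coset has no edges in that coset. -/
theorem chain_of_forall_isPhase {x : G} (hx : ∀ t ≤ p.len, IsPhase p t → x⁻¹ * p.vertex t ∉ H l)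
    {i j : ℕ} (hi : i ≤ p.len) (hj : j ≤ p.len) :
    Chain (AvoidStep H X l x) ((j - i) + (i - j)) (p.vertex i) (p.vertex j) := by
  refine Chain.of_fun_of_symm (fun _ _ h => h.symm) p.vertex
    fun m _ h₂ => p.avoidStep (by omega) fun hlet hxm => ?_
  obtain ⟨a, b, hcomp, ha, hb⟩ := hlet.exists_isComponent
  have hblen := hcomp.2.1
  exact hx a (by omega) hcomp.isPhase_left ((hcomp.mem_iff ha (by omega) x).1 hxm)

/-- A path without backtracking visits a coset on one side of a phase vertex only. -/
theorem NoBacktracking.avoid_or_avoid (hp : NoBacktracking p) {u : ℕ} (hu : IsPhase p u) (l : Λ)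
    (x : G) : (∀ m < u, LetterIsH p l m → x⁻¹ * p.vertex m ∉ H l) ∨
      ∀ m ≥ u, LetterIsH p l m → x⁻¹ * p.vertex m ∉ H l := by
  by_contra! h
  obtain ⟨⟨m, hmu, hlet, hxm⟩, m', hmu', hlet', hxm'⟩ := h
  obtain ⟨a, b, hcomp, ha, hb⟩ := hlet.exists_isComponent
  obtain ⟨a', b', hcomp', ha', hb'⟩ := hlet'.exists_isComponent
  have hxa := (hcomp.mem_iff ha (by omega) x).1 hxm
  have hxa' := (hcomp'.mem_iff ha' (by omega) x).1 hxm'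
  have hconn : (p.vertex a)⁻¹ * p.vertex a' ∈ H l := by
    simpa [mul_assoc] using (H l).mul_mem ((H l).inv_mem hxa) hxa'
  obtain ⟨rfl, rfl⟩ := hp l a b a' b' hcomp hcomp' hconn
  exact hu ⟨l, a, b, hcomp, by omega, by omega⟩

end Components

section PhaseVertices

variable {G : Type*} [Group G] {Λ : Type*} {H : Λ → Subgroup G} {X : Set G}

theorem Chain.avoidStep_of_forall (hX : Subgroup.closure X = ⊤) {l : Λ} {x g h : G} {n : ℕ}
    (hgh : Chain (Step H X) n g h) (hx : ∀ y, relDist H X g y ≤ n → x⁻¹ * y ∉ H l) :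
    Chain (AvoidStep H X l x) n g h := by
  induction hgh with
  | nil g => exact .nil g
  | @snoc n g h k hgh hs ih =>
    refine (ih fun y hy => hx y (hy.trans n.le_succ)).snoc (hs.imp id fun ⟨l', hl'⟩ =>
      ⟨l', hl', fun _ => hx h ((hgh.relDist_le hX).trans n.le_succ)⟩)

/-- Each phase vertex `u` of `p` is close to a phase vertex of `q`, and, for each coset close to
`u`, can be joined to a phase vertex of `q` by a short path without edges in the coset. -/
theorem exists_avoiding_chain_bound (hXfin : X.Finite) (hXgen : Subgroup.closure X = ⊤)
    (hhyp : IsRelHyperbolic H) {lam c : ℝ} (k : ℝ) (hlam : 1 ≤ lam) :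
    ∃ D N : ℕ, ∀ p q : RelPath H X, IsQuasiGeodesic lam c p → IsQuasiGeodesic lam c q →
      Similar k p q → NoBacktracking p → ∀ u ≤ p.len, IsPhase p u →
        (∃ v ≤ q.len, IsPhase q v ∧ relDist H X (p.vertex u) (q.vertex v) ≤ D) ∧
        ∀ l x, relDist H X (p.vertex u) x ≤ D → ∃ j ≤ q.len, IsPhase q j ∧
          ∃ n ≤ N, Chain (AvoidStep H X l x) n (p.vertex u) (q.vertex j) := by
  obtain ⟨D₀, hD₀⟩ := exists_stability_bound (k := k) (c := c) hXfin hXgen hhyp hlam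
  set D := D₀ + 1 with hD
  set L := ⌈lam * (2 * D + 1) + c⌉₊ + 1 with hL
  have hL' : lam * (2 * D + 1) + c < L := by
    rw [hL]
    push_cast
    linarith [Nat.le_ceil (lam * (2 * D + 1) + c)]
  refine ⟨D, L + (D + ⌈k⌉₊), fun p q hp hq hpq hback u hu hup => ?_⟩
  have hnear : ∀ i ≤ p.len, ∃ v ≤ q.len, IsPhase q v ∧
      relDist H X (p.vertex i) (q.vertex v) ≤ D := fun i hi => by
    obtain ⟨j, hj, hij⟩ := hD₀ p q hp hq hpq i hi
    obtain ⟨v, hv, hvp, hjv⟩ := exists_isPhase_near hj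
    exact ⟨v, hv, hvp, (relDist_triangle hXgen _ _ _).trans (add_le_add hij hjv)⟩
  refine ⟨hnear u hu, fun l x hx => ?_⟩
  have hfar : ∀ i ≤ p.len, (i - u) + (u - i) = L → ∃ j ≤ q.len, IsPhase q j ∧
      ∃ n ≤ D + ⌈k⌉₊, Chain (AvoidStep H X l x) n (p.vertex i) (q.vertex j) := by
    intro i hi hiL
    obtain ⟨j, hj, hjp, hij⟩ := hnear i hi
    refine ⟨j, hj, hjp, _, hij.trans (by omega),
      (chain_relDist hXgen _ _).avoidStep_of_forall hXgen fun y hy hxy => ?_⟩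
    have h₁ := hp.sub_le hXgen hu hi
    have h₂ := relDist_triangle (H := H) hXgen (p.vertex u) x (p.vertex i)
    have h₃ := relDist_triangle (H := H) hXgen x y (p.vertex i)
    rw [relDist_comm hXgen y] at h₃
    have h₄ : relDist H X x y ≤ 1 := relDist_le_one_of_mem hxy
    have h₅ : relDist H X (p.vertex u) (p.vertex i) ≤ 2 * D + 1 := by omega
    have h₆ : (relDist H X (p.vertex u) (p.vertex i) : ℝ) ≤ 2 * D + 1 := by exact_mod_cast h₅
    rw [hiL] at h₁
    have := mul_le_mul_of_nonneg_left h₆ (zero_le_one.trans hlam)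
    linarith
  have hend : ∀ g h : G, (xDist X g h : ℝ) ≤ k →
      ∃ n ≤ D + ⌈k⌉₊, Chain (AvoidStep H X l x) n g h := fun g h hgh =>
    ⟨_, le_add_left (Nat.cast_le (α := ℝ).1 (hgh.trans (Nat.le_ceil k))),
      (chain_xDist hXgen g h).mono fun _ _ => Or.inl⟩
  have hjoin : ∀ i ≤ p.len, (i - u) + (u - i) ≤ L →
      (∀ m, min u i ≤ m → m < max u i → LetterIsH p l m → x⁻¹ * p.vertex m ∉ H l) →
      (∃ j ≤ q.len, IsPhase q j ∧
        ∃ n ≤ D + ⌈k⌉₊, Chain (AvoidStep H X l x) n (p.vertex i) (q.vertex j)) →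
      ∃ j ≤ q.len, IsPhase q j ∧
        ∃ n ≤ L + (D + ⌈k⌉₊), Chain (AvoidStep H X l x) n (p.vertex u) (q.vertex j) := by
    rintro i hi hiL havoid ⟨j, hj, hjp, n, hn, hchain⟩
    exact ⟨j, hj, hjp, _, add_le_add hiL hn,
      (Chain.of_fun_of_symm (fun _ _ h => h.symm) p.vertex fun m h₁ h₂ =>
        p.avoidStep (by omega) (havoid m h₁ h₂)).trans hchain⟩
  rcases hback.avoid_or_avoid hup l x with h | h
  · rcases le_total u L with huL | huL
    · exact hjoin 0 (Nat.zero_le _) (by omega) (fun m _ h₂ => h m (by omega))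
        ⟨0, Nat.zero_le _, isPhase_zero q, hend _ _ (by simpa using hpq.1)⟩
    · exact hjoin (u - L) (by omega) (by omega) (fun m _ h₂ => h m (by omega))
        (hfar _ (by omega) (by omega))
  · rcases le_total p.len (u + L) with huL | huL
    · exact hjoin p.len le_rfl (by omega) (fun m h₁ _ => h m (by omega))
        ⟨q.len, le_rfl, isPhase_len q, hend _ _ hpq.2⟩
    · exact hjoin (u + L) huL (by omega) (fun m h₁ _ => h m (by omega))
        (hfar _ huL (by omega))

/-- Phase vertices of `p` are close to phase vertices of `q` with respect to `dist_X`. -/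
theorem exists_phase_bound (hXfin : X.Finite) (hXgen : Subgroup.closure X = ⊤)
    (hhyp : IsRelHyperbolic H) {lam c : ℝ} (k : ℝ) (hlam : 1 ≤ lam) :
    ∃ ε : ℝ, 0 < ε ∧ ∀ p q : RelPath H X, IsQuasiGeodesic lam c p → IsQuasiGeodesic lam c q →
      Similar k p q → NoBacktracking p → ∀ u ≤ p.len, IsPhase p u →
        ∃ v ≤ q.len, IsPhase q v ∧ (xDist X (p.vertex u) (q.vertex v) : ℝ) ≤ ε := by
  obtain ⟨K, hK, hisolated⟩ := exists_isolated_bound hXfin hXgen hhyp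
  obtain ⟨D, N, hDN⟩ := exists_avoiding_chain_bound (c := c) hXfin hXgen hhyp k hlam
  set P := ⌈lam * (N + D + 1) + c⌉₊ with hP
  set B : ℝ := K * ((2 * D + N + P : ℕ) + 2) with hB
  have hB0 : 0 ≤ B := by positivity
  refine ⟨(D + 1) * (B + 1), by positivity, fun p q hp hq hpq hback u hu hup => ?_⟩
  obtain ⟨⟨v, hv, hvp, huv⟩, havoid⟩ := hDN p q hp hq hpq hback u hu hup
  by_contra! hcon
  have hbound : ∀ l x y n, x⁻¹ * y ∈ H l → n ≤ 2 * D + N + P → Chain (AvoidStep H X l x) n x y →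
      (xDist X x y : ℝ) ≤ B := fun l x y n hxy hn hchain =>
    (hisolated l x y n hxy hchain).trans (by rw [hB]; gcongr)
  obtain ⟨o, ho₀, hor, ho⟩ := (chain_relDist (H := H) hXgen (p.vertex u) (q.vertex v)).exists_fun
  set r := relDist H X (p.vertex u) (q.vertex v) with hr
  have ho_le : ∀ i j, i ≤ j → j ≤ r → relDist H X (o i) (o j) ≤ j - i := fun i j hij hj =>
    (Chain.of_fun o hij fun m _ h₂ => ho m (by omega)).relDist_le hXgen
  have ho_ge : ∀ i j, i ≤ j → j ≤ r → j - i ≤ relDist H X (o i) (o j) := fun i j hij hj => by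
    have h₁ := ho_le 0 i (Nat.zero_le i) (by omega)
    have h₂ := ho_le j r hj le_rfl
    have h₃ := relDist_triangle (H := H) hXgen (o 0) (o i) (o r)
    have h₄ := relDist_triangle (H := H) hXgen (o i) (o j) (o r)
    rw [ho₀] at h₁ h₃
    rw [hor] at h₂ h₃ h₄
    omega
  have hsub : ∀ l x i j, relDist H X (p.vertex u) x ≤ D → i ≤ q.len → j ≤ q.len →
      (∃ n ≤ N, Chain (AvoidStep H X l x) n (p.vertex u) (q.vertex i)) →
      relDist H X (p.vertex u) (q.vertex j) ≤ D + 1 → (j - i) + (i - j) ≤ P := by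
    rintro l x i j hx hi hj ⟨n, hn, hchain⟩ hdj
    have h₁ := (hchain.mono fun _ _ h => h.step).relDist_le hXgen
    have h₂ := relDist_triangle (H := H) hXgen (q.vertex i) (p.vertex u) (q.vertex j)
    rw [relDist_comm hXgen (q.vertex i) (p.vertex u)] at h₂
    have h₃ : relDist H X (q.vertex i) (q.vertex j) ≤ N + D + 1 := by omega
    have h₄ : (relDist H X (q.vertex i) (q.vertex j) : ℝ) ≤ N + D + 1 := by exact_mod_cast h₃
    have h₅ := mul_le_mul_of_nonneg_left h₄ (zero_le_one.trans hlam)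
    have h₆ := hq.sub_le hXgen hi hj
    exact Nat.cast_le (α := ℝ).1 (h₆.trans (le_trans (by linarith) (Nat.le_ceil _)))
  have hwalk : ∀ i ≤ r, (xDist X (p.vertex u) (o i) : ℝ) ≤ i * (B + 1) := by
    intro i
    induction i with
    | zero => simp [ho₀]
    | succ i ih =>
      intro hi
      have hui := ih (by omega)
      suffices h : (xDist X (o i) (o (i + 1)) : ℝ) ≤ B + 1 by
        have := xDist_triangle hXgen (p.vertex u) (o i) (o (i + 1))
        have : (xDist X (p.vertex u) (o (i + 1)) : ℝ) ≤
          xDist X (p.vertex u) (o i) + xDist X (o i) (o (i + 1)) := by exact_mod_cast this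
        push_cast
        linarith
      rcases ho i hi with hs | ⟨l, hl⟩
      · have : xDist X (o i) (o (i + 1)) ≤ 1 := wordLength_le_one hs
        have : (xDist X (o i) (o (i + 1)) : ℝ) ≤ 1 := by exact_mod_cast this
        linarith
      have havoid_left : Chain (AvoidStep H X l (o i)) (i - 0) (o 0) (o i) :=
        Chain.of_fun o (Nat.zero_le i) fun m _ h₂ => (ho m (by omega)).imp id
          fun ⟨l', hl'⟩ => ⟨l', hl', fun _ hm => by
            have h₁ := ho_ge m (i + 1) (by omega) hi
            have h₂ : relDist H X (o m) (o (i + 1)) ≤ 1 := relDist_le_one_of_mem (l := l) <| by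
              simpa [mul_assoc] using (H l).mul_mem ((H l).inv_mem hm) hl
            omega⟩
      have havoid_right : Chain (AvoidStep H X l (o i)) (r - (i + 1)) (o (i + 1)) (o r) :=
        Chain.of_fun o hi fun m h₁ h₂ => (ho m h₂).imp id
          fun ⟨l', hl'⟩ => ⟨l', hl', fun hll hm => by
            subst hll
            have h₁ := ho_ge i (m + 1) (by omega) h₂
            have h₂ : relDist H X (o i) (o (m + 1)) ≤ 1 :=
              relDist_le_one_of_mem ((mul_inv_mul_mem_iff hl').2 hm)
            omega⟩
      rw [ho₀] at havoid_left
      rw [hor] at havoid_right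
      have hdi : relDist H X (p.vertex u) (o i) ≤ i :=
        ho₀ ▸ ho_le 0 i (Nat.zero_le i) (by omega)
      obtain ⟨j, hj, hjp, hn'⟩ := havoid l (o i) (by omega)
      obtain ⟨n, hn, hchain⟩ := hn'
      have hstart := (havoid_left.symm fun _ _ h => h.symm).trans hchain
      by_cases hex : ∃ t ≤ q.len, IsPhase q t ∧ (o i)⁻¹ * q.vertex t ∈ H l
      · obtain ⟨t, ht, htp, hxt, hqt⟩ := exists_chain_to_coset hj hjp hex
        exfalso
        have hdt : relDist H X (p.vertex u) (q.vertex t) ≤ D + 1 :=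
          (relDist_triangle hXgen _ (o i) _).trans
            (add_le_add (by omega) (relDist_le_one_of_mem hxt))
        have hlen := hsub l (o i) j t (by omega) hj ht ⟨n, hn, hchain⟩ hdt
        have h₁ := hbound l _ _ _ hxt (by omega) (hstart.trans hqt)
        have h₂ : (xDist X (p.vertex u) (q.vertex t) : ℝ) ≤
            xDist X (p.vertex u) (o i) + xDist X (o i) (q.vertex t) := by
          exact_mod_cast xDist_triangle hXgen (p.vertex u) (o i) (q.vertex t)
        have h₃ : (i : ℝ) * (B + 1) ≤ D * (B + 1) := by
          have : (i : ℝ) ≤ D := by exact_mod_cast (by omega : i ≤ D)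
          gcongr
        linarith [hcon t ht htp]
      · push Not at hex
        have hlen := hsub l (o i) j v (by omega) hj hv ⟨n, hn, hchain⟩ (by omega)
        have := hbound l _ _ _ hl (by omega)
          ((hstart.trans (chain_of_forall_isPhase hex hj hv)).trans
            (havoid_right.symm fun _ _ h => h.symm))
        linarith
  have h₁ := hwalk r le_rfl
  rw [hor] at h₁
  have h₂ : (r : ℝ) * (B + 1) ≤ D * (B + 1) := by
    have : (r : ℝ) ≤ D := by exact_mod_cast huv
    gcongr
  linarith [hcon v hv hvp]

end PhaseVertices

end RelHyp

/-- Proposition 3.15. Let `G` be generated by a finite set `X` and hyperbolic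
relative to `{H₁,…,H_m}`. For any `λ ≥ 1`, `c ≥ 0`, `k ≥ 0` there exists `ε > 0` such that for
any two `k`-similar `(λ,c)`-quasi-geodesics `p, q` in `Γ(G, X ∪ 𝓗)` with `p` without
backtracking, every phase vertex of `p` is `dist_X`-close (within `ε`) to a phase vertex
of `q`. -/
theorem statement_8 {G : Type*} [Group G] {m : ℕ} (H : Fin m → Subgroup G)
    (X : Set G) (hXfin : X.Finite) (hXgen : Subgroup.closure X = ⊤)
    (hhyp : IsRelHyperbolic H) :
    ∀ lam c k : ℝ, 1 ≤ lam → 0 ≤ c → 0 ≤ k →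
      ∃ ε : ℝ, 0 < ε ∧
        ∀ p q : RelPath H X, IsQuasiGeodesic lam c p → IsQuasiGeodesic lam c q →
          Similar k p q → NoBacktracking p →
          ∀ u ≤ p.len, IsPhase p u →
            ∃ v ≤ q.len, IsPhase q v ∧ (xDist X (p.vertex u) (q.vertex v) : ℝ) ≤ ε := by
  intro lam c k hlam _ _
  exact exists_phase_bound hXfin hXgen hhyp k hlam
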